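/- Let d ≥ 1 and γ > 1. The mathematical entropy of a polytropic ideal gas, namely the function (ρ, m, E) ↦ ρ log ρ − (ρ/(γ−1)) log(E/ρ − ‖m‖²/(2ρ²)), is convex on the convex set {(ρ, m, E) ∈ ℝ × ℝ^d × ℝ : ρ > 0 and E − ‖m‖²/(2ρ) > 0}. -/

import Mathlib

/-- The tangent-line inequality for the perspective `(r, x) ↦ x² / r` of the square. -/
lemma two_mul_mul_sub_le_sq_div {r : ℝ} (hr : 0 < r) (t x : ℝ) :
    2 * t * x - t ^ 2 * r ≤ x ^ 2 / r := by
  rw [le_div_iff₀ hr]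
  nlinarith [sq_nonneg (t * r - x)]

lemma convexOn_norm_sq_div {V : Type*} [SeminormedAddCommGroup V] [NormedSpace ℝ V] :
    ConvexOn ℝ {p : ℝ × V | 0 < p.1} (fun p => ‖p.2‖ ^ 2 / p.1) := by
  refine ⟨(convex_Ioi (0 : ℝ)).linear_preimage (LinearMap.fst ℝ ℝ V), ?_⟩
  rintro ⟨r, m⟩ (hr : 0 < r) ⟨s, n⟩ (hs : 0 < s) a b ha hb hab
  have hR : 0 < a * r + b * s := (convex_Ioi (0 : ℝ)) hr hs ha hb hab
  simp only [Prod.smul_mk, Prod.mk_add_mk, smul_eq_mul]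
  have hnorm : ‖a • m + b • n‖ ≤ a * ‖m‖ + b * ‖n‖ := by
    simpa [norm_smul, abs_of_nonneg, ha, hb] using norm_add_le (a • m) (b • n)
  set X := a * ‖m‖ + b * ‖n‖ with hX
  set R := a * r + b * s with hRdef
  have hm := mul_le_mul_of_nonneg_left (two_mul_mul_sub_le_sq_div hr (X / R) ‖m‖) ha
  have hn := mul_le_mul_of_nonneg_left (two_mul_mul_sub_le_sq_div hs (X / R) ‖n‖) hb
  calc ‖a • m + b • n‖ ^ 2 / R ≤ X ^ 2 / R := by gcongr
    _ = 2 * (X / R) * X - (X / R) ^ 2 * R := by field_simp; ring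
    _ = a * (2 * (X / R) * ‖m‖ - (X / R) ^ 2 * r)
        + b * (2 * (X / R) * ‖n‖ - (X / R) ^ 2 * s) := by
      linear_combination 2 * (X / R) * hX - (X / R) ^ 2 * hRdef
    _ ≤ _ := add_le_add hm hn

/-- The tangent-plane inequality for the perspective `(r, x) ↦ r log (x / r)` of the logarithm. -/
lemma mul_log_div_le {r x t : ℝ} (hr : 0 < r) (hx : 0 < x) (ht : 0 < t) :
    r * Real.log (x / r) ≤ r * Real.log t + (x / t - r) := by
  have h := mul_le_mul_of_nonneg_left
    (Real.log_le_sub_one_of_pos (div_pos (div_pos hx hr) ht)) hr.le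
  rw [Real.log_div (div_pos hx hr).ne' ht.ne'] at h
  have h_cancel : r * (x / r / t - 1) = x / t - r := by field_simp
  linarith

lemma concaveOn_mul_log_div :
    ConcaveOn ℝ {p : ℝ × ℝ | 0 < p.1 ∧ 0 < p.2} (fun p => p.1 * Real.log (p.2 / p.1)) := by
  refine ⟨(convex_Ioi (0 : ℝ)).prod (convex_Ioi (0 : ℝ)), ?_⟩
  rintro ⟨r, x⟩ ⟨hr : 0 < r, hx : 0 < x⟩ ⟨s, y⟩ ⟨hs : 0 < s, hy : 0 < y⟩ a b ha hb hab
  have hR : 0 < a * r + b * s := (convex_Ioi (0 : ℝ)) hr hs ha hb hab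
  have hX : 0 < a * x + b * y := (convex_Ioi (0 : ℝ)) hx hy ha hb hab
  simp only [Prod.smul_mk, Prod.mk_add_mk, smul_eq_mul]
  set t := (a * x + b * y) / (a * r + b * s) with ht
  have htpos : 0 < t := div_pos hX hR
  have h₁ := mul_le_mul_of_nonneg_left (mul_log_div_le hr hx htpos) ha
  have h₂ := mul_le_mul_of_nonneg_left (mul_log_div_le hs hy htpos) hb
  have h_cancel : a * (x / t - r) + b * (y / t - s) = 0 := by
    have : (a * x + b * y) / t = a * r + b * s := by rw [ht]; field_simp
    linear_combination this
  linarith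

section InternalEnergy

variable {V : Type*} [SeminormedAddCommGroup V] [NormedSpace ℝ V]

lemma concaveOn_internalEnergy :
    ConcaveOn ℝ {u : ℝ × V × ℝ | 0 < u.1} (fun u => u.2.2 - ‖u.2.1‖ ^ 2 / (2 * u.1)) := by
  have hset : Convex ℝ {u : ℝ × V × ℝ | 0 < u.1} :=
    (convex_Ioi (0 : ℝ)).linear_preimage (LinearMap.fst ℝ ℝ (V × ℝ))
  refine ⟨hset, ?_⟩
  rintro ⟨r, m, x⟩ (hr : 0 < r) ⟨s, n, y⟩ (hs : 0 < s) a b ha hb hab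
  have h := (convexOn_norm_sq_div (V := V)).2 (x := (r, m)) (y := (s, n)) hr hs ha hb hab
  simp only [Prod.smul_mk, Prod.mk_add_mk, smul_eq_mul] at h ⊢
  simp only [mul_comm (2 : ℝ), ← div_div]
  linarith

lemma convex_setOf_pos_internalEnergy :
    Convex ℝ {u : ℝ × V × ℝ | 0 < u.1 ∧ 0 < u.2.2 - ‖u.2.1‖ ^ 2 / (2 * u.1)} :=
  concaveOn_internalEnergy.convex_gt 0

lemma concaveOn_mul_log_specificInternalEnergy :
    ConcaveOn ℝ {u : ℝ × V × ℝ | 0 < u.1 ∧ 0 < u.2.2 - ‖u.2.1‖ ^ 2 / (2 * u.1)}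
      (fun u => u.1 * Real.log (u.2.2 / u.1 - ‖u.2.1‖ ^ 2 / (2 * u.1 ^ 2))) := by
  have h_specific : ∀ u : ℝ × V × ℝ, u.2.2 / u.1 - ‖u.2.1‖ ^ 2 / (2 * u.1 ^ 2)
      = (u.2.2 - ‖u.2.1‖ ^ 2 / (2 * u.1)) / u.1 := fun u => by
    rw [sub_div, div_div, mul_assoc, sq u.1]
  simp only [h_specific]
  refine ⟨convex_setOf_pos_internalEnergy, fun u hu v hv a b ha hb hab => ?_⟩
  have hw := convex_setOf_pos_internalEnergy hu hv ha hb hab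
  have h_log := concaveOn_mul_log_div.2 (x := (u.1, u.2.2 - ‖u.2.1‖ ^ 2 / (2 * u.1)))
    (y := (v.1, v.2.2 - ‖v.2.1‖ ^ 2 / (2 * v.1))) hu hv ha hb hab
  have h_energy := concaveOn_internalEnergy.2 hu.1 hv.1 ha hb hab
  have h_pos : 0 < a • (u.2.2 - ‖u.2.1‖ ^ 2 / (2 * u.1))
      + b • (v.2.2 - ‖v.2.1‖ ^ 2 / (2 * v.1)) :=
    (convex_Ioi (0 : ℝ)) hu.2 hv.2 ha hb hab
  have hρ : 0 < (a • u + b • v).1 := hw.1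
  refine h_log.trans (mul_le_mul_of_nonneg_left (Real.log_le_log (div_pos h_pos hρ) ?_) hρ.le)
  exact div_le_div_of_nonneg_right h_energy hρ.le

end InternalEnergy

/-- The mathematical entropy of a polytropic ideal gas,
`(ρ, m, E) ↦ ρ log ρ − (ρ/(γ−1)) log(E/ρ − ‖m‖²/(2ρ²))`, is convex on the
convex set `{ρ > 0, E − ‖m‖²/(2ρ) > 0}` of conservative variables. -/
theorem mathematicalEntropy_convexOn
    (d : ℕ) (hd : 1 ≤ d) (γ : ℝ) (hγ : 1 < γ) :
    ConvexOn ℝ {u : ℝ × EuclideanSpace ℝ (Fin d) × ℝ |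
        0 < u.1 ∧ 0 < u.2.2 - ‖u.2.1‖ ^ 2 / (2 * u.1)}
      (fun u => u.1 * Real.log u.1
        - (u.1 / (γ - 1)) * Real.log (u.2.2 / u.1 - ‖u.2.1‖ ^ 2 / (2 * u.1 ^ 2))) := by
  have h_density := (Real.convexOn_mul_log.comp_linearMap
    (LinearMap.fst ℝ ℝ (EuclideanSpace ℝ (Fin d) × ℝ))).subset
      (fun _ hu => hu.1.le) convex_setOf_pos_internalEnergy
  have h_energy := (concaveOn_mul_log_specificInternalEnergy
    (V := EuclideanSpace ℝ (Fin d))).smul (inv_nonneg.2 (sub_pos.2 hγ).le)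
  refine (h_density.sub h_energy).congr fun u _ => ?_
  simp only [Pi.sub_apply, Function.comp_apply, LinearMap.fst_apply, smul_eq_mul]
  ring
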